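/- The original smoothing function s₃^{♯}(r) = erf(r) − (2/9)·r·(9 + 6r² − 36r⁴ + 8r⁶)·e^{−r²}/√π satisfies the zeroth moment condition ∫₀^∞ (s₃^{♯}(r) − 1) dr = 0. -/

import Mathlib

open MeasureTheory Real Filter

/-- The error function `erf(r) = (2/√π) ∫₀^r e^{−t²} dt`. -/
noncomputable def erf (r : ℝ) : ℝ :=
  (2 / Real.sqrt Real.pi) * ∫ t in (0:ℝ)..r, Real.exp (-t ^ 2)

/-- The original high-order smoothing function
`s₃^{♯}(r) = erf(r) − (2/9)r(9 + 6r² − 36r⁴ + 8r⁶)e^{−r²}/√π`. -/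
noncomputable def s3SharpOrig (r : ℝ) : ℝ :=
  erf r - (2 / 9) * r * (9 + 6 * r ^ 2 - 36 * r ^ 4 + 8 * r ^ 6) * Real.exp (-r ^ 2) /
    Real.sqrt Real.pi

open Topology

theorem integrable_exp_neg_sq : Integrable (fun t : ℝ => Real.exp (-t ^ 2)) := by
  simpa using integrable_exp_neg_mul_sq one_pos

theorem integrable_pow_mul_exp_neg_sq (n : ℕ) :
    Integrable (fun t : ℝ => t ^ n * Real.exp (-t ^ 2)) := by
  have hn : (-1 : ℝ) < n := by linarith [n.cast_nonneg (α := ℝ)]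
  simpa using integrable_rpow_mul_exp_neg_mul_sq one_pos hn

theorem tendsto_pow_two_mul_exp_neg_sq (n : ℕ) :
    Tendsto (fun r : ℝ => r ^ (2 * n) * Real.exp (-r ^ 2)) atTop (𝓝 0) := by
  simpa [Function.comp_def, pow_mul] using
    (tendsto_pow_mul_exp_neg_atTop_nhds_zero n).comp (tendsto_pow_atTop (α := ℝ) two_ne_zero)

theorem hasDerivAt_exp_neg_sq (r : ℝ) :
    HasDerivAt (fun t : ℝ => Real.exp (-t ^ 2)) (-2 * r * Real.exp (-r ^ 2)) r := by
  refine (hasDerivAt_pow 2 r).fun_neg.exp.congr_deriv ?_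
  push_cast
  ring

theorem hasDerivAt_erf (r : ℝ) :
    HasDerivAt erf (2 / Real.sqrt Real.pi * Real.exp (-r ^ 2)) r :=
  (Continuous.integral_hasStrictDerivAt (by fun_prop) 0 r).hasDerivAt.const_mul _

theorem erf_sub_one_eq (r : ℝ) :
    erf r - 1 = -(2 / Real.sqrt Real.pi) * ∫ t in Set.Ioi r, Real.exp (-t ^ 2) := by
  have hsplit := intervalIntegral.integral_interval_add_Ioi (a := 0) (b := r)
    integrable_exp_neg_sq.integrableOn integrable_exp_neg_sq.integrableOn
  have hgauss : ∫ t in Set.Ioi (0 : ℝ), Real.exp (-t ^ 2) = Real.sqrt Real.pi / 2 := by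
    simpa using integral_gaussian_Ioi 1
  have hpi : Real.sqrt Real.pi ≠ 0 := by positivity
  rw [hgauss] at hsplit
  rw [erf, eq_sub_of_add_eq hsplit]
  field_simp
  ring

theorem erf_sub_one_nonpos (r : ℝ) : erf r - 1 ≤ 0 := by
  rw [erf_sub_one_eq, neg_mul, neg_nonpos]
  have : 0 ≤ ∫ t in Set.Ioi r, Real.exp (-t ^ 2) := integral_nonneg fun t => by positivity
  positivity

theorem tendsto_mul_erf_sub_one : Tendsto (fun r => r * (erf r - 1)) atTop (𝓝 0) := by
  have htail : Tendsto (fun r : ℝ => r * ∫ t in Set.Ioi r, Real.exp (-t ^ 2)) atTop (𝓝 0) := by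
    refine tendsto_of_tendsto_of_tendsto_of_le_of_le' tendsto_const_nhds
      (tendsto_integral_Ioi_zero (f := fun t : ℝ => t ^ 1 * Real.exp (-t ^ 2))
        (μ := volume) tendsto_id) ?_ ?_
    · filter_upwards [eventually_ge_atTop 0] with r hr
      exact mul_nonneg hr (integral_nonneg fun t => by positivity)
    · refine Eventually.of_forall fun r => ?_
      rw [← integral_const_mul]
      refine setIntegral_mono_on (integrable_exp_neg_sq.integrableOn.const_mul r)
        (integrable_pow_mul_exp_neg_sq 1).integrableOn measurableSet_Ioi fun t ht => ?_
      rw [pow_one]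
      exact mul_le_mul_of_nonneg_right (le_of_lt ht) (by positivity)
  have h := htail.const_mul (-(2 / Real.sqrt Real.pi))
  rw [mul_zero] at h
  refine h.congr fun r => ?_
  rw [erf_sub_one_eq]
  ring

theorem integrableOn_erf_sub_one : IntegrableOn (fun r => erf r - 1) (Set.Ioi 0) := by
  have hderiv (r : ℝ) : HasDerivAt
      (fun r => r * (erf r - 1) + Real.exp (-r ^ 2) / Real.sqrt Real.pi) (erf r - 1) r := by
    refine (((hasDerivAt_id' r).fun_mul ((hasDerivAt_erf r).sub_const 1)).fun_add
      ((hasDerivAt_exp_neg_sq r).div_const (Real.sqrt Real.pi))).congr_deriv ?_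
    ring
  have hlim := tendsto_mul_erf_sub_one.add
    ((tendsto_pow_two_mul_exp_neg_sq 0).div_const (Real.sqrt Real.pi))
  simp only [mul_zero, pow_zero, one_mul] at hlim
  exact integrableOn_Ioi_deriv_of_nonpos' (fun r _ => hderiv r)
    (fun r _ => erf_sub_one_nonpos r) hlim

theorem integrableOn_s3SharpOrig_sub_one :
    IntegrableOn (fun r => s3SharpOrig r - 1) (Set.Ioi 0) := by
  have hpoly := (((((integrable_pow_mul_exp_neg_sq 1).const_mul 9).add
    ((integrable_pow_mul_exp_neg_sq 3).const_mul 6)).sub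
    ((integrable_pow_mul_exp_neg_sq 5).const_mul 36)).add
    ((integrable_pow_mul_exp_neg_sq 7).const_mul 8)).const_mul (2 / 9 / Real.sqrt Real.pi)
  refine (integrableOn_erf_sub_one.sub hpoly.integrableOn).congr_fun (fun r _ => ?_)
    measurableSet_Ioi
  simp only [s3SharpOrig, Pi.add_apply, Pi.sub_apply]
  ring

/-- An antiderivative of `s3SharpOrig - 1` vanishing at `0`. -/
noncomputable def s3SharpOrigPrimitive (r : ℝ) : ℝ :=
  r * (erf r - 1) +
    (-2 * r ^ 2 - 4 / 3 * r ^ 4 + 8 / 9 * r ^ 6) * Real.exp (-r ^ 2) / Real.sqrt Real.pi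

theorem hasDerivAt_s3SharpOrigPrimitive (r : ℝ) :
    HasDerivAt s3SharpOrigPrimitive (s3SharpOrig r - 1) r := by
  have hpoly := (((hasDerivAt_pow 2 r).const_mul (-2)).fun_sub
    ((hasDerivAt_pow 4 r).const_mul (4 / 3))).fun_add ((hasDerivAt_pow 6 r).const_mul (8 / 9))
  refine (((hasDerivAt_id' r).fun_mul ((hasDerivAt_erf r).sub_const 1)).fun_add
    ((hpoly.fun_mul (hasDerivAt_exp_neg_sq r)).div_const (Real.sqrt Real.pi))).congr_deriv ?_
  rw [s3SharpOrig]
  push_cast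
  ring

theorem tendsto_s3SharpOrigPrimitive : Tendsto s3SharpOrigPrimitive atTop (𝓝 0) := by
  have h := tendsto_mul_erf_sub_one.add
    (((((tendsto_pow_two_mul_exp_neg_sq 1).const_mul (-2)).sub
      ((tendsto_pow_two_mul_exp_neg_sq 2).const_mul (4 / 3))).add
      ((tendsto_pow_two_mul_exp_neg_sq 3).const_mul (8 / 9))).div_const (Real.sqrt Real.pi))
  simp only [mul_zero, sub_zero, add_zero, zero_div] at h
  refine h.congr fun r => ?_
  rw [s3SharpOrigPrimitive]
  ring

/-- `∫₀^∞ (s₃^{♯}(r) − 1) dr = 0` for the original high-order smoothing function. -/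
theorem zeroth_moment_s3SharpOrig :
    ∫ r in Set.Ioi (0:ℝ), (s3SharpOrig r - 1) = 0 := by
  rw [integral_Ioi_of_hasDerivAt_of_tendsto' (fun r _ => hasDerivAt_s3SharpOrigPrimitive r)
    integrableOn_s3SharpOrig_sub_one tendsto_s3SharpOrigPrimitive]
  simp [s3SharpOrigPrimitive]
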